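/- Let A, B, C be real symmetric n×n matrices, Y ∈ ℝ^{n×r}, ξ, η ∈ ℝ^{n×r}, and ω a real number. Define g_Y(ξ, η) = ω·⟨η, 2AY·Sym(YᵀBξ) + 2BY·Sym(YᵀAξ) + 2Cξ⟩ + ⟨η, Aξ(YᵀBY) + Bξ(YᵀAY)⟩, where ⟨P, Q⟩ = Trace(PᵀQ) and Sym(D) = (D + Dᵀ)/2. Then for every real r×r orthogonal matrix O, g_{YO}(ξO, ηO) = g_Y(ξ, η). -/

import Mathlib

open Matrix

/-- The symmetric part of a square matrix, `Sym(D) = (D + Dᵀ)/2`. -/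
noncomputable def symPart {r : ℕ} (D : Matrix (Fin r) (Fin r) ℝ) : Matrix (Fin r) (Fin r) ℝ :=
  (1 / 2 : ℝ) • (D + Dᵀ)

/-- The metric candidate (48) for the symmetric positive semidefinite fixed-rank problem. -/
noncomputable def gPSD {n r : ℕ}
    (A B C : Matrix (Fin n) (Fin n) ℝ) (ω : ℝ)
    (Y ξ η : Matrix (Fin n) (Fin r) ℝ) : ℝ :=
  ω * (ηᵀ * (2 • (A * Y * symPart (Yᵀ * B * ξ)) + 2 • (B * Y * symPart (Yᵀ * A * ξ)) +
      2 • (C * ξ))).trace +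
  (ηᵀ * (A * ξ * (Yᵀ * B * Y) + B * ξ * (Yᵀ * A * Y))).trace

theorem symPart_transpose_mul_mul {r : ℕ} (D O : Matrix (Fin r) (Fin r) ℝ) :
    symPart (Oᵀ * D * O) = Oᵀ * symPart D * O := by
  simp [symPart, Matrix.mul_add, Matrix.add_mul, Matrix.mul_assoc]

theorem trace_transpose_mul_of_mul_transpose_eq_one {n r : ℕ}
    (P Q : Matrix (Fin n) (Fin r) ℝ) {O : Matrix (Fin r) (Fin r) ℝ} (hO : O * Oᵀ = 1) :
    ((P * O)ᵀ * (Q * O)).trace = (Pᵀ * Q).trace := by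
  rw [transpose_mul, Matrix.mul_assoc, trace_mul_comm, Matrix.mul_assoc, Matrix.mul_assoc, hO,
    Matrix.mul_one]

theorem transpose_mul_mul_mul_right {n r : ℕ} (M : Matrix (Fin n) (Fin n) ℝ)
    (P Q : Matrix (Fin n) (Fin r) ℝ) (O : Matrix (Fin r) (Fin r) ℝ) :
    (P * O)ᵀ * M * (Q * O) = Oᵀ * (Pᵀ * M * Q) * O := by
  simp only [transpose_mul, Matrix.mul_assoc]

theorem mul_mul_conj_of_mul_transpose_eq_one {n r : ℕ} (M : Matrix (Fin n) (Fin n) ℝ)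
    (P : Matrix (Fin n) (Fin r) ℝ) (S : Matrix (Fin r) (Fin r) ℝ)
    {O : Matrix (Fin r) (Fin r) ℝ} (hO : O * Oᵀ = 1) :
    M * (P * O) * (Oᵀ * S * O) = M * P * S * O := by
  calc M * (P * O) * (Oᵀ * S * O) = M * P * (O * Oᵀ) * S * O := by
        simp only [Matrix.mul_assoc]
    _ = M * P * S * O := by rw [hO, Matrix.mul_one]

/-- Invariance of the metric candidate family (48) of the symmetric positive semidefinite
fixed-rank problem under the orthogonal symmetry action `Y ↦ YO`, `ξ ↦ ξO`, `η ↦ ηO`. -/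
theorem metric_invariance_psd_fixed_rank {n r : ℕ}
    (A B C : Matrix (Fin n) (Fin n) ℝ)
    (hA : A.IsSymm) (hB : B.IsSymm) (hC : C.IsSymm)
    (Y ξ η : Matrix (Fin n) (Fin r) ℝ) (ω : ℝ)
    (O : Matrix (Fin r) (Fin r) ℝ) (hO : Oᵀ * O = 1) (hO' : O * Oᵀ = 1) :
    gPSD A B C ω (Y * O) (ξ * O) (η * O) = gPSD A B C ω Y ξ η := by
  unfold gPSD
  simp only [transpose_mul_mul_mul_right, symPart_transpose_mul_mul,
    mul_mul_conj_of_mul_transpose_eq_one _ _ _ hO']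
  rw [← Matrix.mul_assoc C ξ O]
  simp only [← Matrix.smul_mul, ← Matrix.add_mul,
    trace_transpose_mul_of_mul_transpose_eq_one _ _ hO']
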